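/- Let τ₀ ∈ ℝ and let μ be a probability measure on ℝ^N that is absolutely continuous with respect to the product Gibbs measure λ^N_{β,τ₀}, with finite relative entropy H(μ‖λ^N_{β,τ₀}) := ∫ (dμ/dλ^N) log(dμ/dλ^N) dλ^N and ∫ Σ_{i=1}^N |r_i| dμ < ∞. Then for every a ∈ ℝ: a · ( ∫ Σ_{i=1}^N r_i dμ − N β⁻¹ G'(τ₀) ) ≤ H(μ‖λ^N_{β,τ₀}) + N a² / (2βc₁). -/

import Mathlib

open MeasureTheory Real Set Finset

/-- The canonical Gibbs function `G(τ) = log ∫ exp(-βV(r) + βτr) dr`. -/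
noncomputable def gibbsG (β : ℝ) (V : ℝ → ℝ) (τ : ℝ) : ℝ :=
  Real.log (∫ r : ℝ, Real.exp (-β * V r + β * τ * r))

/-- One-site Gibbs density `exp(-βV(r) + βτr - G(τ))`. -/
noncomputable def gibbsDensity (β : ℝ) (V : ℝ → ℝ) (τ r : ℝ) : ℝ :=
  Real.exp (-β * V r + β * τ * r - gibbsG β V τ)

/-- The `N`-fold product Gibbs measure `λ^N_{β,τ}` on `ℝ^N`. -/
noncomputable def gibbsPi (β : ℝ) (V : ℝ → ℝ) (τ : ℝ) (N : ℕ) : Measure (Fin N → ℝ) :=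
  volume.withDensity fun x => ENNReal.ofReal (∏ i, gibbsDensity β V τ (x i))

open ProbabilityTheory

/-- A function with second derivative bounded below by `c` lies above its tangent parabolas. -/
lemma tangent_add_sq_le_of_le_deriv2 {g : ℝ → ℝ} {c : ℝ} (hg : Differentiable ℝ g)
    (hg' : Differentiable ℝ (deriv g)) (hc : ∀ x, c ≤ deriv (deriv g) x) (x y : ℝ) :
    g y + deriv g y * (x - y) + c / 2 * (x - y) ^ 2 ≤ g x := by
  have hd : ∀ z, HasDerivAt (fun z => g z - deriv g y * (z - y) - c / 2 * (z - y) ^ 2)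
      (deriv g z - deriv g y - c * (z - y)) z := fun z => by
    have h1 := (hasDerivAt_id' z).sub_const y
    convert! ((hg z).hasDerivAt.sub (h1.const_mul (deriv g y))).sub
      ((h1.pow 2).const_mul (c / 2)) using 1
    norm_num
    ring
  have hcont : Continuous (fun z => g z - deriv g y * (z - y) - c / 2 * (z - y) ^ 2) :=
    continuous_iff_continuousAt.2 fun z => (hd z).continuousAt
  rcases le_total y x with h | h
  · have hm := monotoneOn_of_deriv_nonneg (convex_Ici y) hcont.continuousOn
      (fun z _ => (hd z).differentiableAt.differentiableWithinAt) (fun z hz => by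
        rw [interior_Ici] at hz
        have := mul_sub_le_image_sub_of_le_deriv hg' hc (le_of_lt hz)
        rw [(hd z).deriv]; linarith)
    have := hm Set.self_mem_Ici h h
    simp only [sub_self] at this
    linarith
  · have hm := antitoneOn_of_deriv_nonpos (convex_Iic y) hcont.continuousOn
      (fun z _ => (hd z).differentiableAt.differentiableWithinAt) (fun z hz => by
        rw [interior_Iic] at hz
        have := mul_sub_le_image_sub_of_le_deriv hg' hc (le_of_lt hz)
        rw [(hd z).deriv]; linarith)
    have := hm h Set.self_mem_Iic h
    simp only [sub_self] at this
    linarith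

lemma mul_sq_le_sub_mul_sub_of_le_deriv {g : ℝ → ℝ} {c : ℝ} (hg : Differentiable ℝ g)
    (hc : ∀ x, c ≤ deriv g x) (x y : ℝ) :
    c * (x - y) ^ 2 ≤ (x - y) * (g x - g y) := by
  rcases le_total x y with h | h
  · nlinarith [mul_sub_le_image_sub_of_le_deriv hg hc h]
  · nlinarith [mul_sub_le_image_sub_of_le_deriv hg hc h]

lemma integrable_withDensity_ofReal_iff {α : Type*} {m : MeasurableSpace α} {μ : Measure α}
    {p : α → ℝ} (hp : Measurable p) (hp0 : ∀ x, 0 ≤ p x) {h : α → ℝ} :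
    Integrable h (μ.withDensity fun x => ENNReal.ofReal (p x)) ↔
      Integrable (fun x => p x * h x) μ := by
  rw [integrable_withDensity_iff_integrable_smul' hp.ennreal_ofReal
    (ae_of_all _ fun _ => ENNReal.ofReal_lt_top)]
  simp [ENNReal.toReal_ofReal, hp0]

lemma integral_withDensity_ofReal {α : Type*} {m : MeasurableSpace α} {μ : Measure α}
    {p : α → ℝ} (hp : Measurable p) (hp0 : ∀ x, 0 ≤ p x) (h : α → ℝ) :
    ∫ x, h x ∂(μ.withDensity fun x => ENNReal.ofReal (p x)) = ∫ x, p x * h x ∂μ := by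
  rw [integral_withDensity_eq_integral_toReal_smul hp.ennreal_ofReal
    (ae_of_all _ fun _ => ENNReal.ofReal_lt_top)]
  simp [ENNReal.toReal_ofReal, hp0]

lemma integrable_exp_quadratic {b : ℝ} (hb : b < 0) (c d : ℝ) :
    Integrable fun x : ℝ => Real.exp (b * x ^ 2 + c * x + d) := by
  have h := (integrable_cexp_quadratic' (b := (b : ℂ)) (by simpa using hb) c d).norm
  refine h.congr (ae_of_all _ fun x => ?_)
  simp only [Complex.norm_exp]
  congr 1
  norm_cast

section UniformlyConvex

variable {U : ℝ → ℝ} {c C : ℝ}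

lemma integrable_exp_neg_add_mul (hc0 : 0 < c) (hU : Differentiable ℝ U)
    (hU' : Differentiable ℝ (deriv U)) (hc : ∀ x, c ≤ deriv (deriv U) x) (t : ℝ) :
    Integrable fun x : ℝ => Real.exp (-U x + t * x) := by
  refine (integrable_exp_quadratic (b := -(c / 2)) (by linarith) (t - deriv U 0) (-U 0)).mono'
    (by have := hU.continuous; fun_prop) (ae_of_all _ fun x => ?_)
  rw [Real.norm_of_nonneg (Real.exp_nonneg _), Real.exp_le_exp]
  have := tangent_add_sq_le_of_le_deriv2 hU hU' hc x 0
  simp only [sub_zero] at this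
  linarith

/-- The measure on `ℝ` with unnormalized density `exp (-U)`. -/
noncomputable def expNegMeasure (U : ℝ → ℝ) : Measure ℝ :=
  volume.withDensity fun x => ENNReal.ofReal (Real.exp (-U x))

lemma integrable_expNegMeasure_iff (hU : Continuous U) {h : ℝ → ℝ} :
    Integrable h (expNegMeasure U) ↔ Integrable fun x => Real.exp (-U x) * h x :=
  integrable_withDensity_ofReal_iff (by fun_prop) (fun _ => Real.exp_nonneg _)

lemma integral_expNegMeasure (hU : Continuous U) (h : ℝ → ℝ) :
    ∫ x, h x ∂(expNegMeasure U) = ∫ x, Real.exp (-U x) * h x :=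
  integral_withDensity_ofReal (by fun_prop) (fun _ => Real.exp_nonneg _) h

lemma integrableExpSet_expNegMeasure (hc0 : 0 < c) (hU : Differentiable ℝ U)
    (hU' : Differentiable ℝ (deriv U)) (hc : ∀ x, c ≤ deriv (deriv U) x) :
    integrableExpSet id (expNegMeasure U) = univ := by
  refine eq_univ_of_forall fun t => (integrable_expNegMeasure_iff hU.continuous).2 ?_
  simpa only [id_eq, ← Real.exp_add] using integrable_exp_neg_add_mul hc0 hU hU' hc t

lemma mgf_expNegMeasure (hU : Continuous U) (t : ℝ) :
    mgf id (expNegMeasure U) t = ∫ x, Real.exp (-U x + t * x) := by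
  simp only [mgf, id_eq, integral_expNegMeasure hU, Real.exp_add]

/-- Brascamp-Lieb bound for the variance of an exponential tilt of `exp (-U)`. -/
lemma deriv2_cgf_expNegMeasure_le (hc0 : 0 < c) (hU : Differentiable ℝ U)
    (hU' : Differentiable ℝ (deriv U)) (hc : ∀ x, c ≤ deriv (deriv U) x)
    (hC : ∀ x, deriv (deriv U) x ≤ C) (t : ℝ) :
    deriv (deriv (cgf id (expNegMeasure U))) t ≤ 1 / c := by
  have hUc := hU.continuous
  have hmem : t ∈ interior (integrableExpSet id (expNegMeasure U)) := by
    simp [integrableExpSet_expNegMeasure hc0 hU hU' hc]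
  have hpos : 0 < mgf id (expNegMeasure U) t := by
    rw [mgf_expNegMeasure hUc]
    exact integral_exp_pos (integrable_exp_neg_add_mul hc0 hU hU' hc t)
  have hint : ∀ n : ℕ, Integrable fun x : ℝ => x ^ n * Real.exp (-U x + t * x) := fun n => by
    have := (integrable_expNegMeasure_iff hUc).1
      (integrable_pow_mul_exp_of_mem_interior_integrableExpSet hmem n)
    refine this.congr (ae_of_all _ fun x => ?_)
    simp only [id_eq, Real.exp_add]
    ring
  have hderiv : deriv (deriv (cgf id (expNegMeasure U))) t =
      (∫ x, (x - deriv (cgf id (expNegMeasure U)) t) ^ 2 * Real.exp (-U x + t * x)) /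
        mgf id (expNegMeasure U) t := by
    rw [← iteratedDeriv_one (f := deriv _), ← iteratedDeriv_succ',
      iteratedDeriv_two_cgf_eq_integral hmem, integral_expNegMeasure hUc]
    congr 2
    ext x
    simp only [id_eq, Real.exp_add]
    ring
  have hmean : deriv (cgf id (expNegMeasure U)) t * mgf id (expNegMeasure U) t =
      ∫ x, x * Real.exp (-U x + t * x) := by
    rw [deriv_cgf hmem, div_mul_cancel₀ _ hpos.ne', integral_expNegMeasure hUc]
    congr 1
    ext x
    simp only [id_eq, Real.exp_add]
    ring
  rw [hderiv, div_le_div_iff₀ hpos hc0, one_mul]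
  generalize deriv (cgf id (expNegMeasure U)) t = m at hmean ⊢
  rw [mgf_expNegMeasure hUc] at hmean ⊢
  set e : ℝ → ℝ := fun x => Real.exp (-U x + t * x) with he
  have h0 : Integrable e := by simpa using hint 0
  have h1 : Integrable fun x => x * e x := by simpa using hint 1
  have h1' : Integrable fun x => (x - m) * e x := by
    simp only [sub_mul]
    exact h1.sub (h0.const_mul m)
  have h2' : Integrable fun x => (x - m) ^ 2 * e x := by
    refine (((hint 2).sub (h1.const_mul (2 * m))).add (h0.const_mul (m ^ 2))).congr
      (ae_of_all _ fun x => ?_)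
    simp only [Pi.add_apply, Pi.sub_apply, he]
    ring
  have hzero : ∫ x, (x - m) * e x = 0 := by
    simp only [sub_mul]
    rw [integral_sub h1 (h0.const_mul m), integral_const_mul, ← hmean, sub_self]
  have hlow : ∀ x, c * (x - m) ^ 2 ≤ (x - m) * (deriv U x - deriv U m) :=
    fun x => mul_sq_le_sub_mul_sub_of_le_deriv hU' hc x m
  have hupp : ∀ x, (x - m) * (deriv U x - deriv U m) ≤ C * (x - m) ^ 2 := fun x => by
    have := mul_sq_le_sub_mul_sub_of_le_deriv hU'.neg (c := -C)
      (fun x => by rw [deriv.neg]; exact neg_le_neg (hC x)) x m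
    simp only [Pi.neg_apply] at this
    linarith
  have hU'c := hU'.continuous
  have h3 : Integrable fun x => (x - m) * (deriv U x - deriv U m) * e x := by
    refine (h2'.const_mul C).mono' (by fun_prop) (ae_of_all _ fun x => ?_)
    have he0 : 0 ≤ e x := Real.exp_nonneg _
    have hn : 0 ≤ (x - m) * (deriv U x - deriv U m) := (by positivity : 0 ≤ c * (x - m) ^ 2).trans (hlow x)
    rw [Real.norm_of_nonneg (mul_nonneg hn he0), ← mul_assoc]
    exact mul_le_mul_of_nonneg_right (hupp x) he0
  have hparts := integral_eq_zero_of_hasDerivAt_of_integrable (f := fun x => (x - m) * e x)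
    (f' := fun x => e x - (x - m) * (deriv U x - deriv U m) * e x
      - (deriv U m - t) * ((x - m) * e x)) (fun x => by
        have hex : HasDerivAt e (e x * (-deriv U x + t)) x := by
          convert! ((hU x).hasDerivAt.neg.add ((hasDerivAt_id' x).const_mul t)).exp using 1
          simp [he]
        convert! ((hasDerivAt_id' x).sub_const m).mul hex using 1
        ring) ((h0.sub h3).sub (h1'.const_mul _)) h1'
  rw [integral_sub (f := fun x => e x - (x - m) * (deriv U x - deriv U m) * e x) (h0.sub h3)
      (h1'.const_mul _), integral_const_mul, hzero, mul_zero, sub_zero,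
    integral_sub h0 h3] at hparts
  have hmono : ∫ x, c * ((x - m) ^ 2 * e x) ≤
      ∫ x, (x - m) * (deriv U x - deriv U m) * e x :=
    integral_mono (h2'.const_mul c) h3 fun x => by
      simp only [← mul_assoc]
      exact mul_le_mul_of_nonneg_right (hlow x) (Real.exp_nonneg _)
  rw [integral_const_mul] at hmono
  linarith

lemma cgf_expNegMeasure_add_le (hc0 : 0 < c) (hU : Differentiable ℝ U)
    (hU' : Differentiable ℝ (deriv U)) (hc : ∀ x, c ≤ deriv (deriv U) x)
    (hC : ∀ x, deriv (deriv U) x ≤ C) (t a : ℝ) :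
    cgf id (expNegMeasure U) (t + a) ≤ cgf id (expNegMeasure U) t +
      a * deriv (cgf id (expNegMeasure U)) t + a ^ 2 / (2 * c) := by
  have han : ∀ s, AnalyticAt ℝ (cgf id (expNegMeasure U)) s := fun s => analyticAt_cgf (by
    simp [integrableExpSet_expNegMeasure hc0 hU hU' hc])
  have h := tangent_add_sq_le_of_le_deriv2 (g := -cgf id (expNegMeasure U)) (c := -(1 / c))
    (fun s => (han s).differentiableAt.neg)
    (fun s => (han s).neg.deriv.differentiableAt)
    (fun s => by
      rw [deriv.neg', deriv.fun_neg]
      exact neg_le_neg (deriv2_cgf_expNegMeasure_le hc0 hU hU' hc hC s)) (t + a) t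
  rw [deriv.neg'] at h
  simp only [Pi.neg_apply, add_sub_cancel_left] at h
  have : a ^ 2 / (2 * c) = 1 / c / 2 * a ^ 2 := by field_simp
  linarith

end UniformlyConvex

/-- Donsker-Varadhan inequality for a test function with normalized exponential. -/
lemma integral_mul_le_integral_mul_log {α : Type*} {m : MeasurableSpace α} {μ : Measure α}
    {f φ : α → ℝ} (hf0 : ∀ x, 0 ≤ f x) (hf : Integrable f μ) (hf1 : ∫ x, f x ∂μ = 1)
    (hlog : Integrable (fun x => f x * Real.log (f x)) μ)
    (hφ : Integrable (fun x => f x * φ x) μ) (hexp : Integrable (fun x => Real.exp (φ x)) μ)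
    (hexp1 : ∫ x, Real.exp (φ x) ∂μ = 1) :
    ∫ x, f x * φ x ∂μ ≤ ∫ x, f x * Real.log (f x) ∂μ := by
  have key : ∫ x, f x * φ x ∂μ ≤ ∫ x, (f x * Real.log (f x) - f x + Real.exp (φ x)) ∂μ := by
    refine integral_mono hφ ((hlog.sub hf).add hexp) fun x => ?_
    simp only
    rcases (hf0 x).eq_or_lt with h | h
    · simp [← h, Real.exp_nonneg]
    · have h1 := Real.add_one_le_exp (φ x - Real.log (f x))
      rw [Real.exp_sub, Real.exp_log h, le_div_iff₀ h] at h1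
      linarith
  rw [integral_add (f := fun x => f x * Real.log (f x) - f x) (hlog.sub hf) hexp, integral_sub hlog hf, hf1, hexp1] at key
  linarith

section Gibbs

variable {β : ℝ} {V : ℝ → ℝ}

lemma gibbsG_eq_cgf (hV : Continuous V) (τ : ℝ) :
    gibbsG β V τ = cgf id (expNegMeasure fun r => β * V r) (β * τ) := by
  rw [gibbsG, cgf, mgf_expNegMeasure (by fun_prop)]
  simp only [neg_mul]

lemma integral_gibbsDensity (τ : ℝ)
    (h : Integrable fun r : ℝ => Real.exp (-β * V r + β * τ * r)) :
    ∫ r, gibbsDensity β V τ r = 1 := by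
  simp only [gibbsDensity, Real.exp_sub]
  rw [integral_div, gibbsG, Real.exp_log (integral_exp_pos h), div_self (integral_exp_pos h).ne']

end Gibbs

/-- Entropy inequality: if `μ = f λ^N_{β,τ₀}` is a probability measure
with finite relative entropy and `∫ Σ|rᵢ| dμ < ∞`, then for every `a ∈ ℝ`,
`a (∫ Σ rᵢ dμ - N β⁻¹ G'(τ₀)) ≤ H(μ‖λ^N) + N a²/(2βc₁)`. -/
theorem relativeEntropy_mean_stretch_bound
    (β c₁ c₂ τ₀ : ℝ) (V : ℝ → ℝ)
    (hβ : 0 < β) (hc₁ : 0 < c₁) (hc₁₂ : c₁ ≤ c₂)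
    (hV : ContDiff ℝ 2 V)
    (hV'' : ∀ r : ℝ, c₁ ≤ deriv (deriv V) r ∧ deriv (deriv V) r ≤ c₂)
    (N : ℕ) (hN : 1 ≤ N)
    (f : (Fin N → ℝ) → ℝ)
    (hf_meas : Measurable f)
    (hf_nonneg : ∀ x, 0 ≤ f x)
    (hf_prob : (∫ x, f x ∂(gibbsPi β V τ₀ N)) = 1)
    (hf_int : Integrable f (gibbsPi β V τ₀ N))
    (h_entropy : Integrable (fun x => f x * Real.log (f x)) (gibbsPi β V τ₀ N))
    (h_abs : Integrable (fun x => (∑ i, |x i|) * f x) (gibbsPi β V τ₀ N))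
    (a : ℝ) :
    a * ((∫ x, (∑ i, x i) * f x ∂(gibbsPi β V τ₀ N)) -
        N * (β⁻¹ * deriv (gibbsG β V) τ₀)) ≤
      (∫ x, f x * Real.log (f x) ∂(gibbsPi β V τ₀ N)) + N * a ^ 2 / (2 * β * c₁) := by
  have hVd : Differentiable ℝ V := hV.differentiable two_ne_zero
  have hVd' : Differentiable ℝ (deriv V) :=
    ((contDiff_succ_iff_deriv (n := 1)).1 hV).2.2.differentiable one_ne_zero
  set U : ℝ → ℝ := fun r => β * V r with hUdef
  have hdU : deriv U = fun r => β * deriv V r := funext fun r => deriv_const_mul _ (hVd r)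
  have hddU : ∀ r, deriv (deriv U) r = β * deriv (deriv V) r := fun r => by
    rw [hdU, deriv_const_mul _ (hVd' r)]
  have hU : Differentiable ℝ U := hVd.const_mul β
  have hU' : Differentiable ℝ (deriv U) := hdU ▸ hVd'.const_mul β
  have hlow : ∀ r, β * c₁ ≤ deriv (deriv U) r := fun r => by
    rw [hddU]; exact mul_le_mul_of_nonneg_left (hV'' r).1 hβ.le
  have hupp : ∀ r, deriv (deriv U) r ≤ β * c₂ := fun r => by
    rw [hddU]; exact mul_le_mul_of_nonneg_left (hV'' r).2 hβ.le
  have hκ : 0 < β * c₁ := mul_pos hβ hc₁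
  have hVc := hVd.continuous
  have hG : gibbsG β V = fun τ => cgf id (expNegMeasure U) (β * τ) :=
    funext fun τ => gibbsG_eq_cgf hVc τ
  have hG' : β⁻¹ * deriv (gibbsG β V) τ₀ = deriv (cgf id (expNegMeasure U)) (β * τ₀) := by
    rw [hG, deriv_comp_mul_left, smul_eq_mul, inv_mul_cancel_left₀ hβ.ne']
  set τ₁ : ℝ := τ₀ + a / β with hτ₁
  have hβτ₁ : β * τ₁ = β * τ₀ + a := by rw [hτ₁]; field_simp
  have hGbound : gibbsG β V τ₁ - gibbsG β V τ₀ ≤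
      a * (β⁻¹ * deriv (gibbsG β V) τ₀) + a ^ 2 / (2 * (β * c₁)) := by
    rw [hG', hG]
    simp only [hβτ₁]
    linarith [cgf_expNegMeasure_add_le hκ hU hU' hlow hupp (β * τ₀) a]
  have hexpint : ∀ τ, Integrable fun r : ℝ => Real.exp (-β * V r + β * τ * r) := fun τ => by
    simpa only [hUdef, neg_mul] using integrable_exp_neg_add_mul hκ hU hU' hlow (β * τ)
  have hdens_cont : ∀ τ, Continuous (gibbsDensity β V τ) := fun τ => by
    unfold gibbsDensity; fun_prop
  have hdens_int : Integrable (gibbsDensity β V τ₁) := by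
    unfold gibbsDensity
    simpa only [Real.exp_sub] using (hexpint τ₁).div_const _
  set p : (Fin N → ℝ) → ℝ := fun x => ∏ i, gibbsDensity β V τ₀ (x i) with hp
  have hp_meas : Measurable p := by
    have := (hdens_cont τ₀).measurable
    fun_prop
  have hp0 : ∀ x, 0 ≤ p x := fun x => Finset.prod_nonneg fun i _ => Real.exp_nonneg _
  set D : ℝ := N * (gibbsG β V τ₁ - gibbsG β V τ₀) with hD
  set φ : (Fin N → ℝ) → ℝ := fun x => a * (∑ i, x i) - D with hφdef
  have hq : (fun x => p x * Real.exp (φ x)) = fun x => ∏ i, gibbsDensity β V τ₁ (x i) := by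
    ext x
    simp only [hp, hφdef, gibbsDensity, ← Real.exp_sum, ← Real.exp_add]
    congr 1
    have hcard : D = ∑ _i : Fin N, (gibbsG β V τ₁ - gibbsG β V τ₀) := by simp [hD, mul_sub]
    rw [hcard, Finset.mul_sum, ← Finset.sum_sub_distrib, ← Finset.sum_add_distrib]
    refine Finset.sum_congr rfl fun i _ => ?_
    rw [hβτ₁]
    ring
  have hexp : Integrable (fun x => Real.exp (φ x)) (gibbsPi β V τ₀ N) := by
    refine (integrable_withDensity_ofReal_iff hp_meas hp0).2 ?_
    rw [hq]
    exact Integrable.fintype_prod fun _ => hdens_int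
  have hexp1 : ∫ x, Real.exp (φ x) ∂(gibbsPi β V τ₀ N) = 1 := by
    refine (integral_withDensity_ofReal hp_meas hp0 _).trans ?_
    rw [hq, integral_fintype_prod_volume_eq_pow, integral_gibbsDensity τ₁ (hexpint τ₁), one_pow]
  have hS : Integrable (fun x => (∑ i, x i) * f x) (gibbsPi β V τ₀ N) := by
    refine h_abs.mono (by fun_prop) (ae_of_all _ fun x => ?_)
    rw [norm_mul, norm_mul]
    refine mul_le_mul_of_nonneg_right ?_ (norm_nonneg _)
    exact (Finset.abs_sum_le_sum_abs _ _).trans (le_abs_self _)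
  have hfφ : (fun x => f x * φ x) = fun x => a * ((∑ i, x i) * f x) - D * f x := by
    ext x
    simp only [hφdef]
    ring
  have key := integral_mul_le_integral_mul_log hf_nonneg hf_int hf_prob h_entropy
    (hfφ ▸ (hS.const_mul a).sub (hf_int.const_mul D)) hexp hexp1
  rw [hfφ, integral_sub (hS.const_mul a) (hf_int.const_mul D), integral_const_mul,
    integral_const_mul, hf_prob] at key
  have hNbound := mul_le_mul_of_nonneg_left hGbound (Nat.cast_nonneg (α := ℝ) N)
  rw [← hD] at hNbound
  have : (N : ℝ) * a ^ 2 / (2 * β * c₁) = N * (a ^ 2 / (2 * (β * c₁))) := by ring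
  rw [this]
  linarith
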